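/- Let p > 3 be a prime and let Γ be a connected Z/p-reduced Z/p-graph of rank n = 2(p-1) on which Z/p acts nontrivially. Then Γ is isomorphic as a Z/p-graph to one of the following: the rose R_{2(p-1)} with Z/p cyclically permuting p of the petals and fixing the remaining p-2 petals; a graph Θ_{p-1}^{s,t} with s + t = p - 1, with Z/p cyclically rotating the p edges of Θ_{p-1} and fixing all attached loops; or Θ_{p-1} ∨ Θ_{p-1} with the diagonal Z/p-action rotating the p edges of each copy of Θ_{p-1}. -/

import Mathlib

set_option maxHeartbeats 800000

/-!
Formalization of statements from:
H. Glover, H.-W. Henn, "On the mod-p cohomology of Out(F_{2(p-1)})".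
-/

noncomputable section
namespace OutFormal

/-! ### Finite graphs `(V, E, σ, t)` -/

/-- A finite graph: finite sets of vertices and (oriented) edges, a fixed-point-free
involution `σ` pairing each oriented edge with its opposite, and a terminal vertex map
`t`. -/
structure FinGraph where
  V : Type
  E : Type
  [fintypeV : Fintype V]
  [fintypeE : Fintype E]
  edgeInv : E → E
  t : E → V
  edgeInv_invol : ∀ e, edgeInv (edgeInv e) = e
  edgeInv_ne : ∀ e, edgeInv e ≠ e

attribute [instance] FinGraph.fintypeV FinGraph.fintypeE

namespace FinGraph

variable (Γ : FinGraph)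

/-- The source (initial vertex) of an oriented edge. -/
def src (e : Γ.E) : Γ.V := Γ.t (Γ.edgeInv e)

/-- `Walk Γ u w l`: the list of oriented edges `l` is an edge path from `u` to `w`. -/
inductive Walk : Γ.V → Γ.V → List Γ.E → Prop
  | nil (v : Γ.V) : Walk v v []
  | cons {w : Γ.V} (e : Γ.E) {l : List Γ.E} (h : Walk (Γ.t e) w l) :
      Walk (Γ.src e) w (e :: l)

/-- Connectivity of a graph. -/
def Connected : Prop := ∀ u w : Γ.V, ∃ l, Γ.Walk u w l

/-- The number of geometric edges: the number of `σ`-orbits of oriented edges. -/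
def edgeCount : ℕ := Fintype.card Γ.E / 2

/-- The number of vertices. -/
def vertexCount : ℕ := Fintype.card Γ.V

/-- The rank (first Betti number) of a connected graph:
`(number of geometric edges) − (number of vertices) + 1`. -/
def rank : ℕ := Γ.edgeCount + 1 - Γ.vertexCount

/-- The valency of a vertex: the number of oriented edges ending at it. -/
def valency (v : Γ.V) : ℕ := by
  classical
  exact Fintype.card {e : Γ.E // Γ.t e = v}

/-- A reduced (backtracking-free) edge path. -/
def Reduced (l : List Γ.E) : Prop := l.Chain' (fun a b => b ≠ Γ.edgeInv a)

/-- A set of oriented edges, closed under `σ`, is a forest if it supports no nonempty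
reduced closed walk. -/
def IsForest (F : Set Γ.E) : Prop :=
  (∀ e ∈ F, Γ.edgeInv e ∈ F) ∧
  ∀ v l, l ≠ [] → (∀ e ∈ l, e ∈ F) → Γ.Walk v v l → ¬ Γ.Reduced l

/-- There is no separating (geometric) edge: any two vertices can be joined by an edge
path avoiding any given geometric edge. -/
def NoSepEdge : Prop :=
  ∀ (e₀ : Γ.E) (u w : Γ.V), ∃ l, Γ.Walk u w l ∧ e₀ ∉ l ∧ Γ.edgeInv e₀ ∉ l

/-- An admissible graph: connected, all valencies at least `3`, no separating edges. -/
def Admissible : Prop :=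
  Γ.Connected ∧ (∀ v, 3 ≤ Γ.valency v) ∧ Γ.NoSepEdge

end FinGraph

/-- An isomorphism of graphs. -/
structure GIso (Γ₁ Γ₂ : FinGraph) where
  eV : Γ₁.V ≃ Γ₂.V
  eE : Γ₁.E ≃ Γ₂.E
  map_edgeInv : ∀ e, eE (Γ₁.edgeInv e) = Γ₂.edgeInv (eE e)
  map_t : ∀ e, eV (Γ₁.t e) = Γ₂.t (eE e)

namespace FinGraph

variable (Γ : FinGraph)

/-- The graph obtained from `Γ` by collapsing each tree of the forest `F` (given with
its closure under `σ`) to a point: the vertices are identified along the edges of `F`,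
and the edges of `F` are deleted. -/
def collapse (F : Set Γ.E) (hF : ∀ e ∈ F, Γ.edgeInv e ∈ F) : FinGraph where
  V := Quotient (Relation.EqvGen.setoid (fun v w => ∃ e ∈ F, Γ.src e = v ∧ Γ.t e = w))
  E := {e : Γ.E // e ∉ F}
  fintypeV := @Quotient.fintype _ _ _ (Classical.decRel _)
  fintypeE := @Subtype.fintype _ _ (Classical.decPred _) _
  edgeInv := fun e => ⟨Γ.edgeInv e.1, fun h => e.2 (by
    have := hF _ h
    rwa [Γ.edgeInv_invol] at this)⟩
  t := fun e => Quotient.mk _ (Γ.t e.1)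
  edgeInv_invol := fun e => Subtype.ext (Γ.edgeInv_invol e.1)
  edgeInv_ne := fun e h => Γ.edgeInv_ne e.1 (congrArg Subtype.val h)

end FinGraph


/-! ### The model `Z/p`-graphs: the rose, `Θ_{p-1}^{s,t}`, and `Θ_{p-1} ∨ Θ_{p-1}` -/

/-- The rose with `p + m` petals, `p` of which will be cyclically permuted. -/
def roseModel (p m : ℕ) : FinGraph where
  V := Unit
  E := (Fin p ⊕ Fin m) × Bool
  edgeInv := fun e => (e.1, !e.2)
  t := fun _ => ()
  edgeInv_invol := fun e => by simp
  edgeInv_ne := fun e h => by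
    have := congrArg Prod.snd h
    simp at this

/-- The rotation of the rose, cyclically permuting the `p` distinguished petals and
fixing the remaining `m` petals. -/
def roseRot (p m : ℕ) : GIso (roseModel p m) (roseModel p m) where
  eV := Equiv.refl _
  eE := Equiv.prodCongr ((finRotate p).sumCongr (Equiv.refl _)) (Equiv.refl _)
  map_edgeInv := fun e => rfl
  map_t := fun e => rfl

/-- The graph `Θ_{p-1}^{s,t}`: two vertices `0, 1`, joined by `p` edges, with `s` loops
attached at the vertex `0` and `t` loops at the vertex `1`. -/
def thetaModel (p s t : ℕ) : FinGraph where
  V := Fin 2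
  E := (Fin p × Bool) ⊕ ((Fin s ⊕ Fin t) × Bool)
  edgeInv := fun e => match e with
    | Sum.inl (j, b) => Sum.inl (j, !b)
    | Sum.inr (c, b) => Sum.inr (c, !b)
  t := fun e => match e with
    | Sum.inl (_, true) => 1
    | Sum.inl (_, false) => 0
    | Sum.inr (Sum.inl _, _) => 0
    | Sum.inr (Sum.inr _, _) => 1
  edgeInv_invol := fun e => by rcases e with ⟨j, b⟩ | ⟨c, b⟩ <;> simp
  edgeInv_ne := fun e h => by
    rcases e with ⟨j, b⟩ | ⟨c, b⟩ <;>
      · simp only [Sum.inl.injEq, Sum.inr.injEq, Prod.mk.injEq] at h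
        rcases h with ⟨-, h2⟩
        simp at h2

/-- The rotation of `Θ_{p-1}^{s,t}`, cyclically rotating the `p` edges of `Θ_{p-1}` and
fixing all attached loops. -/
def thetaRot (p s t : ℕ) : GIso (thetaModel p s t) (thetaModel p s t) where
  eV := Equiv.refl _
  eE := Equiv.sumCongr (Equiv.prodCongr (finRotate p) (Equiv.refl _)) (Equiv.refl _)
  map_edgeInv := fun e => by rcases e with ⟨j, b⟩ | ⟨c, b⟩ <;> rfl
  map_t := fun e => by rcases e with ⟨j, b | b⟩ | ⟨c | c, b⟩ <;> rfl

/-- The wedge `Θ_{p-1} ∨ Θ_{p-1}`: vertices `0` (left), `1` (wedge point), `2` (right),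
with `p` edges between `0, 1` and `p` edges between `1, 2`. -/
def wedgeModel (p : ℕ) : FinGraph where
  V := Fin 3
  E := (Fin p × Bool) ⊕ (Fin p × Bool)
  edgeInv := fun e => match e with
    | Sum.inl (j, b) => Sum.inl (j, !b)
    | Sum.inr (j, b) => Sum.inr (j, !b)
  t := fun e => match e with
    | Sum.inl (_, true) => 0
    | Sum.inl (_, false) => 1
    | Sum.inr (_, true) => 2
    | Sum.inr (_, false) => 1
  edgeInv_invol := fun e => by rcases e with ⟨j, b⟩ | ⟨j, b⟩ <;> simp
  edgeInv_ne := fun e h => by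
    rcases e with ⟨j, b⟩ | ⟨j, b⟩ <;>
      · simp only [Sum.inl.injEq, Sum.inr.injEq, Prod.mk.injEq] at h
        rcases h with ⟨-, h2⟩
        simp at h2

/-- The diagonal rotation of `Θ_{p-1} ∨ Θ_{p-1}`, cyclically rotating the `p` edges of
each of the two copies of `Θ_{p-1}`. -/
def wedgeRot (p : ℕ) : GIso (wedgeModel p) (wedgeModel p) where
  eV := Equiv.refl _
  eE := Equiv.sumCongr (Equiv.prodCongr (finRotate p) (Equiv.refl _))
    (Equiv.prodCongr (finRotate p) (Equiv.refl _))
  map_edgeInv := fun e => by rcases e with ⟨j, b⟩ | ⟨j, b⟩ <;> rfl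
  map_t := fun e => by rcases e with ⟨j, b | b⟩ | ⟨j, b | b⟩ <;> rfl

/-! ### Auxiliary lemmas -/

section Aux

theorem iter_mod {X : Type} {f : X → X} {p : ℕ} {x : X} (hf : f^[p] x = x) (i : ℕ) :
    f^[i % p] x = f^[i] x :=
  Function.IsPeriodicPt.iterate_mod_apply hf i

theorem iter_inj {X : Type} {f : X → X} {p : ℕ} (hp : p.Prime) {x : X} (hf : f^[p] x = x)
    (hx : f x ≠ x) {i j : ℕ} (h : f^[i] x = f^[j] x) : i % p = j % p := by
  have := Fact.mk hp
  have hm : Function.minimalPeriod f x = p := Function.minimalPeriod_eq_prime hf hx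
  rw [← iter_mod hf i, ← iter_mod hf j] at h
  exact (Function.iterate_eq_iterate_iff_of_lt_minimalPeriod
    (by rw [hm]; exact Nat.mod_lt _ hp.pos) (by rw [hm]; exact Nat.mod_lt _ hp.pos)).1 h

theorem card_mod {X : Type} [Fintype X] {p : ℕ} (hp : p.Prime) (f : X → X)
    (hf : ∀ x, f^[p] x = x) :
    Nat.card X ≡ Nat.card {x // f x = x} [MOD p] := by
  classical
  have := Fact.mk hp
  have h1 : (show Function.End X from f) ^ p ^ 1 = 1 := by
    rw [pow_one]
    funext x
    have : ∀ n : ℕ, ((show Function.End X from f) ^ n) = f^[n] := by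
      intro n
      induction n with
      | zero => rfl
      | succ n ih => rw [pow_succ, ih]; rfl
    rw [this]
    exact hf x
  have := Equiv.Perm.card_fixedPoints_modEq h1
  rw [← Nat.card_eq_fintype_card, ← Nat.card_eq_fintype_card] at this
  exact this

/-- Orienting a fixed point free involution. -/
theorem orient {X : Type} [Finite X] (σ : X → X) (h1 : ∀ x, σ (σ x) = x)
    (h2 : ∀ x, σ x ≠ x) :
    ∃ (n : ℕ) (φ : Fin n × Bool ≃ X), ∀ i b, φ (i, !b) = σ (φ (i, b)) := by
  classical
  obtain ⟨N, ⟨k⟩⟩ := Finite.exists_equiv_fin X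
  obtain ⟨n, ⟨r⟩⟩ := Finite.exists_equiv_fin {x : X // k x < k (σ x)}
  let f : Fin n × Bool → X := fun y => bif y.2 then (r.symm y.1).1 else σ (r.symm y.1).1
  have hsi : Function.Injective σ := fun a b h => by rw [← h1 a, h, h1]
  have hne : ∀ i j : {x : X // k x < k (σ x)}, i.1 ≠ σ j.1 := by
    intro i j h
    have a := i.2
    have b := j.2
    rw [h, h1] at a
    exact lt_asymm a b
  have hinj : Function.Injective f := by
    rintro ⟨i, b⟩ ⟨j, c⟩ h
    cases b <;> cases c
    · simp only [f, cond_false] at h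
      have := r.symm.injective (Subtype.ext (hsi h))
      rw [this]
    · exact absurd h.symm (hne _ _)
    · exact absurd h (hne _ _)
    · simp only [f, cond_true] at h
      have := r.symm.injective (Subtype.ext h)
      rw [this]
  have hsur : Function.Surjective f := by
    intro x
    rcases lt_trichotomy (k x) (k (σ x)) with h | h | h
    · exact ⟨(r ⟨x, h⟩, true), by simp [f]⟩
    · exact absurd (k.injective h).symm (h2 x)
    · exact ⟨(r ⟨σ x, by rw [h1]; exact h⟩, false), by simp [f, h1]⟩
  refine ⟨n, Equiv.ofBijective f ⟨hinj, hsur⟩, ?_⟩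
  intro i b
  cases b
  · exact (h1 _).symm
  · rfl

variable {Γ : FinGraph} {α : GIso Γ Γ}

theorem iter_inv (i : ℕ) (e : Γ.E) :
    (α.eE : Γ.E → Γ.E)^[i] (Γ.edgeInv e) = Γ.edgeInv ((α.eE : Γ.E → Γ.E)^[i] e) := by
  induction i with
  | zero => rfl
  | succ n ih => rw [Function.iterate_succ_apply', Function.iterate_succ_apply', ih, α.map_edgeInv]

theorem iter_t (i : ℕ) (e : Γ.E) :
    Γ.t ((α.eE : Γ.E → Γ.E)^[i] e) = (α.eV : Γ.V → Γ.V)^[i] (Γ.t e) := by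
  induction i with
  | zero => rfl
  | succ n ih => rw [Function.iterate_succ_apply', Function.iterate_succ_apply', ← ih, α.map_t]

theorem iter_src (i : ℕ) (e : Γ.E) :
    Γ.src ((α.eE : Γ.E → Γ.E)^[i] e) = (α.eV : Γ.V → Γ.V)^[i] (Γ.src e) := by
  rw [FinGraph.src, ← iter_inv, iter_t]; rfl

theorem walk_cons {u w : Γ.V} {e : Γ.E} {l : List Γ.E} (h : Γ.Walk u w (e :: l)) :
    u = Γ.src e ∧ Γ.Walk (Γ.t e) w l := by
  cases h with
  | cons e h => exact ⟨rfl, h⟩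

theorem walk_nil {u w : Γ.V} (h : Γ.Walk u w []) : u = w := by
  cases h; rfl

theorem src_inv (e : Γ.E) : Γ.src (Γ.edgeInv e) = Γ.t e := by
  rw [FinGraph.src, Γ.edgeInv_invol]

theorem t_inv (e : Γ.E) : Γ.t (Γ.edgeInv e) = Γ.src e := rfl

/-- A criterion for forests: a union of stars with leaves `t f`, `f ∈ P`. -/
theorem star_forest (P : Γ.E → Prop)
    (h1 : ∀ f g, P f → P g → Γ.t f = Γ.t g → f = g)
    (h2 : ∀ f g, P f → P g → Γ.src f ≠ Γ.t g) :
    Γ.IsForest {f | P f ∨ P (Γ.edgeInv f)} := by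
  have step : ∀ a b, (P a ∨ P (Γ.edgeInv a)) → (P b ∨ P (Γ.edgeInv b)) →
      Γ.t a = Γ.src b → b ≠ Γ.edgeInv a → P (Γ.edgeInv a) ∧ P b := by
    intro a b ha hb hab hne
    rcases ha with ha | ha <;> rcases hb with hb | hb
    · exact absurd hab.symm (h2 b a hb ha)
    · have := h1 _ _ ha hb hab
      exact absurd (by rw [this, Γ.edgeInv_invol]) hne
    · exact ⟨ha, hb⟩
    · refine absurd ?_ (h2 _ _ ha hb)
      rw [src_inv]; exact hab
  refine ⟨?_, ?_⟩
  · rintro e (he | he)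
    · exact Or.inr (by rwa [Γ.edgeInv_invol])
    · exact Or.inl he
  · intro v l hl hF hw hr
    rcases l with _ | ⟨a, _ | ⟨b, _ | ⟨c, l⟩⟩⟩
    · exact hl rfl
    · obtain ⟨hv, hw⟩ := walk_cons hw
      have := walk_nil hw
      rcases hF a (by simp) with ha | ha
      · exact h2 a a ha ha (by rw [← hv, this])
      · refine h2 _ _ ha ha ?_
        rw [src_inv, t_inv, ← hv, this]
    · obtain ⟨hv, hw⟩ := walk_cons hw
      obtain ⟨hv2, hw⟩ := walk_cons hw
      have hv3 := walk_nil hw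
      have hne : b ≠ Γ.edgeInv a := by
        have hr' : List.IsChain (fun a b => b ≠ Γ.edgeInv a) [a, b] := hr
        simpa using hr'
      obtain ⟨ha, hb⟩ := step a b (hF a (by simp)) (hF b (by simp)) hv2 hne
      exact hne (h1 _ _ hb ha (by rw [hv3, t_inv, hv]))
    · obtain ⟨hv, hw⟩ := walk_cons hw
      obtain ⟨hv2, hw⟩ := walk_cons hw
      obtain ⟨hv3, hw⟩ := walk_cons hw
      have hne : b ≠ Γ.edgeInv a ∧ c ≠ Γ.edgeInv b := by
        have hr' : List.IsChain (fun a b => b ≠ Γ.edgeInv a) (a :: b :: c :: l) := hr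
        rw [List.isChain_cons_cons, List.isChain_cons_cons] at hr'
        exact ⟨hr'.1, hr'.2.1⟩
      obtain ⟨-, hb⟩ := step a b (hF a (by simp)) (hF b (by simp)) hv2 hne.1
      obtain ⟨hb', -⟩ := step b c (hF b (by simp)) (hF c (by simp)) hv3 hne.2
      exact h2 _ _ hb hb' rfl

variable {p : ℕ}

theorem iter_mul_fix {X : Type} {f : X → X} (hf : ∀ x, f^[p] x = x) (j : ℕ) (x : X) :
    f^[p * j] x = x := by
  rw [Function.iterate_mul]
  exact Function.iterate_fixed (hf x) j

theorem key
    (hp : p.Prime)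
    (hαE : ∀ e, (α.eE : Γ.E → Γ.E)^[p] e = e)
    (hαV : ∀ v, (α.eV : Γ.V → Γ.V)^[p] v = v)
    (hred : ∀ F, Γ.IsForest F → F.Nonempty → ¬ (∀ e ∈ F, α.eE e ∈ F))
    (e : Γ.E) (he : ∀ k, (α.eV : Γ.V → Γ.V)^[k] (Γ.src e) ≠ Γ.t e) :
    α.eE e ≠ e ∧ α.eV (Γ.t e) = Γ.t e := by
  by_contra hcon
  let P : Γ.E → Prop := fun f => ∃ i, f = (α.eE : Γ.E → Γ.E)^[i] e
  refine hred {f | P f ∨ P (Γ.edgeInv f)} (star_forest P ?_ ?_) ⟨e, Or.inl ⟨0, rfl⟩⟩ ?_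
  · rintro f g ⟨i, rfl⟩ ⟨j, rfl⟩ h
    by_cases hfix : α.eE e = e
    · rw [Function.iterate_fixed hfix, Function.iterate_fixed hfix]
    · rw [iter_t, iter_t] at h
      have hv : α.eV (Γ.t e) ≠ Γ.t e := fun h => hcon ⟨hfix, h⟩
      have := iter_inj hp (hαV _) hv h
      rw [← iter_mod (hαE e) i, this, iter_mod (hαE e) j]
  · rintro f g ⟨i, rfl⟩ ⟨j, rfl⟩ h
    rw [iter_t, iter_src] at h
    refine he ((p - 1) * j + i) ?_
    rw [Function.iterate_add_apply, h, ← Function.iterate_add_apply]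
    have : (p - 1) * j + j = p * j := by
      obtain ⟨q, rfl⟩ := Nat.exists_eq_succ_of_ne_zero hp.pos.ne'
      simp only [Nat.succ_sub_one, Nat.succ_mul]
    rw [this]
    exact iter_mul_fix hαV j _
  · rintro f (⟨i, hi⟩ | ⟨i, hi⟩)
    · exact Or.inl ⟨i + 1, by rw [hi, Function.iterate_succ_apply']⟩
    · exact Or.inr ⟨i + 1, by rw [← α.map_edgeInv, hi, Function.iterate_succ_apply']⟩

theorem key'
    (hp : p.Prime)
    (hαE : ∀ e, (α.eE : Γ.E → Γ.E)^[p] e = e)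
    (hαV : ∀ v, (α.eV : Γ.V → Γ.V)^[p] v = v)
    (hred : ∀ F, Γ.IsForest F → F.Nonempty → ¬ (∀ e ∈ F, α.eE e ∈ F))
    (e : Γ.E) : (∃ k, (α.eV : Γ.V → Γ.V)^[k] (Γ.src e) = Γ.t e) ∨
    (α.eE e ≠ e ∧ α.eV (Γ.t e) = Γ.t e ∧ α.eV (Γ.src e) = Γ.src e) := by
  by_cases h : ∃ k, (α.eV : Γ.V → Γ.V)^[k] (Γ.src e) = Γ.t e
  · exact Or.inl h
  · right
    have h' : ∀ k, (α.eV : Γ.V → Γ.V)^[k] (Γ.src e) ≠ Γ.t e := fun k hk => h ⟨k, hk⟩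
    obtain ⟨h1, h2⟩ := key hp hαE hαV hred e h'
    refine ⟨h1, h2, ?_⟩
    refine (key hp hαE hαV hred (Γ.edgeInv e) ?_).2
    intro k hk
    rw [src_inv, t_inv, Function.iterate_fixed h2] at hk
    exact h' 0 hk.symm

theorem card_E_even (Γ : FinGraph) : Nat.card Γ.E = 2 * Γ.edgeCount := by
  obtain ⟨n, φ, -⟩ := orient Γ.edgeInv Γ.edgeInv_invol Γ.edgeInv_ne
  have h := Nat.card_congr φ
  rw [FinGraph.edgeCount, ← Nat.card_eq_fintype_card, ← h]
  simp
  omega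

theorem walk_invariant (S : Γ.V → Prop) (hS : ∀ e, S (Γ.src e) → S (Γ.t e))
    {u w : Γ.V} {l : List Γ.E} (h : Γ.Walk u w l) : S u → S w := by
  induction h with
  | nil v => exact id
  | cons e h ih => exact fun h => ih (hS e h)

theorem all_fixed
    (hp : p.Prime)
    (hαE : ∀ e, (α.eE : Γ.E → Γ.E)^[p] e = e)
    (hαV : ∀ v, (α.eV : Γ.V → Γ.V)^[p] v = v)
    (hred : ∀ F, Γ.IsForest F → F.Nonempty → ¬ (∀ e ∈ F, α.eE e ∈ F))
    (hp3 : 3 < p) (hconn : Γ.Connected) (hrank : Γ.rank = 2 * (p - 1)) (v : Γ.V) :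
    α.eV v = v := by
  by_contra hv
  have hnf : ∀ k, α.eV ((α.eV : Γ.V → Γ.V)^[k] v) ≠ (α.eV : Γ.V → Γ.V)^[k] v := by
    intro k hk
    rw [← Function.iterate_succ_apply' (⇑α.eV), Function.iterate_succ_apply] at hk
    exact hv (α.eV.injective.iterate k hk)
  have horb : ∀ w, ∃ k, w = (α.eV : Γ.V → Γ.V)^[k] v := by
    intro w
    obtain ⟨l, hl⟩ := hconn v w
    refine walk_invariant (fun w => ∃ k, w = (α.eV : Γ.V → Γ.V)^[k] v) ?_ hl ⟨0, rfl⟩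
    rintro e ⟨k, hk⟩
    rcases key' hp hαE hαV hred e with ⟨j, hj⟩ | ⟨-, -, h⟩
    · exact ⟨j + k, by rw [Function.iterate_add_apply, ← hk, hj]⟩
    · rw [hk] at h
      exact absurd h (hnf k)
  have hfree : ∀ w, α.eV w ≠ w := by
    intro w
    obtain ⟨k, rfl⟩ := horb w
    exact hnf k
  have hfreeE : ∀ e, α.eE e ≠ e := by
    intro e h
    apply hfree (Γ.t e)
    rw [α.map_t, h]
  have hV : Nat.card Γ.V ≡ 0 [MOD p] := by
    have h := card_mod hp (α.eV : Γ.V → Γ.V) hαV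
    have : IsEmpty {x // α.eV x = x} := ⟨fun x => hfree x.1 x.2⟩
    rwa [Nat.card_of_isEmpty (α := {x // _})] at h
  have hE : Nat.card Γ.E ≡ 0 [MOD p] := by
    have h := card_mod hp (α.eE : Γ.E → Γ.E) hαE
    have : IsEmpty {x // α.eE x = x} := ⟨fun x => hfreeE x.1 x.2⟩
    rwa [Nat.card_of_isEmpty (α := {x // _})] at h
  have hle : Nat.card Γ.V ≤ p := by
    have hs : Function.Surjective (fun i : Fin p => (α.eV : Γ.V → Γ.V)^[i.1] v) := by
      intro w
      obtain ⟨k, rfl⟩ := horb w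
      exact ⟨⟨k % p, Nat.mod_lt _ hp.pos⟩, iter_mod (hαV v) k⟩
    have := Nat.card_le_card_of_surjective _ hs
    simpa using this
  have hpos : 0 < Nat.card Γ.V := by
    have : Nonempty Γ.V := ⟨v⟩
    exact Nat.card_pos
  have hVp : Nat.card Γ.V = p :=
    le_antisymm hle (Nat.le_of_dvd hpos ((Nat.modEq_zero_iff_dvd).1 hV))
  have hd : p ∣ Γ.edgeCount := by
    have h := (Nat.modEq_zero_iff_dvd).1 hE
    rw [card_E_even] at h
    rcases hp.dvd_mul.1 h with h | h
    · have := Nat.le_of_dvd (by norm_num) h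
      omega
    · exact h
  have hvc : Γ.vertexCount = p := by
    rw [FinGraph.vertexCount, ← Nat.card_eq_fintype_card, hVp]
  rw [FinGraph.rank, hvc] at hrank
  obtain ⟨c, hc⟩ := hd
  have h3 : p * c + 3 = p * 3 := by omega
  have : p ∣ 3 := by
    rw [Nat.dvd_add_iff_right (m := p * c) (n := 3) ⟨c, rfl⟩, h3]
    exact ⟨3, rfl⟩
  have := Nat.le_of_dvd (by norm_num) this
  omega

/-! ### Free edge orbits -/

/-- The (oriented) edges in the orbit of a geometric edge. -/
def orb (p : ℕ) (α : GIso Γ Γ) (e : Γ.E) : Fin p × Bool → Γ.E := fun x =>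
  bif x.2 then (α.eE : Γ.E → Γ.E)^[x.1.1] e else Γ.edgeInv ((α.eE : Γ.E → Γ.E)^[x.1.1] e)

theorem orb_inv (e : Γ.E) (i : Fin p) (b : Bool) :
    orb p α e (i, !b) = Γ.edgeInv (orb p α e (i, b)) := by
  cases b
  · exact (Γ.edgeInv_invol _).symm
  · rfl

theorem orb_rot
    (hp : p.Prime)
    (hαE : ∀ e, (α.eE : Γ.E → Γ.E)^[p] e = e)
    (e : Γ.E) (i : Fin p) (b : Bool) :
    orb p α e (finRotate p i, b) = α.eE (orb p α e (i, b)) := by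
  have h : (α.eE : Γ.E → Γ.E)^[(finRotate p i).1] e = α.eE ((α.eE : Γ.E → Γ.E)^[i.1] e) := by
    obtain ⟨q, rfl⟩ := Nat.exists_eq_succ_of_ne_zero hp.pos.ne'
    have hv : (finRotate (q + 1) i).1 = (i.1 + 1) % (q + 1) := by
      rw [finRotate_succ_apply, Fin.val_add]
      simp
    rw [hv, iter_mod (hαE e), Function.iterate_succ_apply']
  cases b
  · simp only [orb, cond_false]
    rw [h, α.map_edgeInv]
  · exact h

theorem inv_inj {a b : Γ.E} (h : Γ.edgeInv a = Γ.edgeInv b) : a = b := by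
  rw [← Γ.edgeInv_invol a, h, Γ.edgeInv_invol]

theorem orb_inj
    (hp : p.Prime)
    (hαE : ∀ e, (α.eE : Γ.E → Γ.E)^[p] e = e)
    (hp3 : 3 < p) {e : Γ.E} (he : α.eE e ≠ e) :
    Function.Injective (orb p α e) := by
  have h1 : ∀ i j : Fin p, (α.eE : Γ.E → Γ.E)^[i.1] e = (α.eE : Γ.E → Γ.E)^[j.1] e → i = j := by
    intro i j h
    have := iter_inj hp (hαE e) he h
    rw [Nat.mod_eq_of_lt i.2, Nat.mod_eq_of_lt j.2] at this
    exact Fin.ext this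
  have h2 : ∀ i j : Fin p, (α.eE : Γ.E → Γ.E)^[i.1] e ≠
      Γ.edgeInv ((α.eE : Γ.E → Γ.E)^[j.1] e) := by
    intro i j h
    have h' : (α.eE : Γ.E → Γ.E)^[j.1] e = Γ.edgeInv ((α.eE : Γ.E → Γ.E)^[i.1] e) := by
      rw [h, Γ.edgeInv_invol]
    have h3 : (α.eE : Γ.E → Γ.E)^[i.1 + i.1] e = (α.eE : Γ.E → Γ.E)^[j.1 + j.1] e := by
      rw [Function.iterate_add_apply, Function.iterate_add_apply]
      conv_lhs => rw [h]
      conv_rhs => rw [h']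
      rw [iter_inv, iter_inv, ← Function.iterate_add_apply, ← Function.iterate_add_apply,
        add_comm]
    have h4 : i.1 + i.1 ≡ j.1 + j.1 [MOD p] := iter_inj hp (hαE e) he h3
    rw [← two_mul, ← two_mul] at h4
    have hc : Nat.gcd p 2 = 1 :=
      (Nat.coprime_primes hp Nat.prime_two).2 (by omega)
    have h5 : i.1 ≡ j.1 [MOD p] := Nat.ModEq.cancel_left_of_coprime hc h4
    have h6 : i.1 = j.1 := by
      have : i.1 % p = j.1 % p := h5
      rwa [Nat.mod_eq_of_lt i.2, Nat.mod_eq_of_lt j.2] at this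
    rw [h6] at h
    exact Γ.edgeInv_ne _ h.symm
  rintro ⟨i, b⟩ ⟨j, c⟩ h
  cases b <;> cases c
  · rw [h1 i j (inv_inj h)]
  · exact absurd h.symm (h2 _ _)
  · exact absurd h (h2 _ _)
  · rw [h1 i j h]

theorem orb_nf {e : Γ.E} (he : α.eE e ≠ e) (x : Fin p × Bool) :
    α.eE (orb p α e x) ≠ orb p α e x := by
  have h1 : ∀ i : ℕ, α.eE ((α.eE : Γ.E → Γ.E)^[i] e) ≠ (α.eE : Γ.E → Γ.E)^[i] e := by
    intro k hk
    rw [← Function.iterate_succ_apply' (⇑α.eE), Function.iterate_succ_apply] at hk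
    exact he (α.eE.injective.iterate k hk)
  obtain ⟨i, b⟩ := x
  cases b
  · intro h
    simp only [orb, cond_false] at h
    rw [α.map_edgeInv] at h
    exact h1 _ (inv_inj h)
  · exact h1 _

theorem orb_t_true (hfix : ∀ v, α.eV v = v) (e : Γ.E) (i : Fin p) :
    Γ.t (orb p α e (i, true)) = Γ.t e :=
  (iter_t _ _).trans (Function.iterate_fixed (hfix _) _)

theorem orb_t_false (hfix : ∀ v, α.eV v = v) (e : Γ.E) (i : Fin p) :
    Γ.t (orb p α e (i, false)) = Γ.src e :=
  (iter_src _ _).trans (Function.iterate_fixed (hfix _) _)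

theorem orb_src_true (hfix : ∀ v, α.eV v = v) (e : Γ.E) (i : Fin p) :
    Γ.src (orb p α e (i, true)) = Γ.src e :=
  (iter_src _ _).trans (Function.iterate_fixed (hfix _) _)

theorem orb_src_false (hfix : ∀ v, α.eV v = v) (e : Γ.E) (i : Fin p) :
    Γ.src (orb p α e (i, false)) = Γ.t e :=
  (src_inv _).trans ((iter_t _ _).trans (Function.iterate_fixed (hfix _) _))

theorem mkIso (hp3 : 3 < p) (hfix : ∀ v, α.eV v = v) (M : FinGraph) (R : GIso M M)
    (g : M.V → Γ.V) (hg : Function.Bijective g)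
    (f : M.E → Γ.E) (hf : Function.Bijective f)
    (h1 : ∀ x, f (M.edgeInv x) = Γ.edgeInv (f x)) (h2 : ∀ x, Γ.t (f x) = g (M.t x))
    (h3 : ∀ x, f (R.eE x) = α.eE (f x)) :
    ∃ (ψ : GIso Γ M) (m : ℕ), m % p ≠ 0 ∧
      (∀ e, ψ.eE (α.eE e) = (R.eE : _ → _)^[m] (ψ.eE e)) ∧
      (∀ v, ψ.eV (α.eV v) = ψ.eV v) := by
  let F : M.E ≃ Γ.E := Equiv.ofBijective f hf
  let G : M.V ≃ Γ.V := Equiv.ofBijective g hg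
  have hF : ∀ x, F x = f x := fun _ => rfl
  have hG : ∀ x, G x = g x := fun _ => rfl
  refine ⟨⟨G.symm, F.symm, ?_, ?_⟩, 1, ?_, ?_, ?_⟩
  · intro e
    obtain ⟨x, rfl⟩ := F.surjective e
    rw [Equiv.symm_apply_eq, Equiv.symm_apply_apply, hF, hF, h1]
  · intro e
    obtain ⟨x, rfl⟩ := F.surjective e
    rw [Equiv.symm_apply_eq, Equiv.symm_apply_apply, hF, hG, h2]
  · rw [Nat.mod_eq_of_lt (by omega)]
    exact one_ne_zero
  · intro e
    obtain ⟨x, rfl⟩ := F.surjective e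
    simp only [Function.iterate_one]
    rw [Equiv.symm_apply_eq, Equiv.symm_apply_apply, hF, hF, h3]
  · intro v
    rw [hfix]

theorem fixed_loop
    (hp : p.Prime)
    (hαE : ∀ e, (α.eE : Γ.E → Γ.E)^[p] e = e)
    (hαV : ∀ v, (α.eV : Γ.V → Γ.V)^[p] v = v)
    (hred : ∀ F, Γ.IsForest F → F.Nonempty → ¬ (∀ e ∈ F, α.eE e ∈ F))
    (hfix : ∀ v, α.eV v = v) {e : Γ.E} (he : α.eE e = e) : Γ.src e = Γ.t e := by
  rcases key' hp hαE hαV hred e with ⟨k, hk⟩ | ⟨h, -⟩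
  · rwa [Function.iterate_fixed (hfix _)] at hk
  · exact absurd he h

theorem loops
    (hp : p.Prime)
    (hαE : ∀ e, (α.eE : Γ.E → Γ.E)^[p] e = e)
    (hαV : ∀ v, (α.eV : Γ.V → Γ.V)^[p] v = v)
    (hred : ∀ F, Γ.IsForest F → F.Nonempty → ¬ (∀ e ∈ F, α.eE e ∈ F))
    (hfix : ∀ v, α.eV v = v) (v : Γ.V) :
    ∃ (n : ℕ) (φ : Fin n × Bool → Γ.E), Function.Injective φ ∧
      (∀ x, α.eE (φ x) = φ x ∧ Γ.t (φ x) = v) ∧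
      (∀ i b, φ (i, !b) = Γ.edgeInv (φ (i, b))) ∧
      Nat.card {e // α.eE e = e ∧ Γ.t e = v} = 2 * n := by
  have hX : ∀ e : {e // α.eE e = e ∧ Γ.t e = v},
      α.eE (Γ.edgeInv e.1) = Γ.edgeInv e.1 ∧ Γ.t (Γ.edgeInv e.1) = v := by
    rintro ⟨e, h1, h2⟩
    refine ⟨(α.map_edgeInv e).trans (congrArg Γ.edgeInv h1), ?_⟩
    rw [t_inv, fixed_loop hp hαE hαV hred hfix h1, h2]
  obtain ⟨n, φ, hφ⟩ := orient (X := {e // α.eE e = e ∧ Γ.t e = v})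
    (fun e => ⟨Γ.edgeInv e.1, hX e⟩)
    (fun e => Subtype.ext (Γ.edgeInv_invol _))
    (fun e h => Γ.edgeInv_ne e.1 (congrArg Subtype.val h))
  refine ⟨n, fun x => (φ x).1, Subtype.val_injective.comp φ.injective, fun x => (φ x).2, ?_, ?_⟩
  · intro i b
    exact congrArg Subtype.val (hφ i b)
  · rw [← Nat.card_congr φ]
    simp [mul_comm]

theorem cut (hconn : Γ.Connected) (S : Γ.V → Prop) {u w : Γ.V} (hu : S u) (hw : ¬ S w) :
    ∃ e, S (Γ.src e) ∧ ¬ S (Γ.t e) := by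
  by_contra h
  push Not at h
  obtain ⟨l, hl⟩ := hconn u w
  exact hw (walk_invariant S h hl hu)

theorem nonloop_nf
    (hp : p.Prime)
    (hαE : ∀ e, (α.eE : Γ.E → Γ.E)^[p] e = e)
    (hαV : ∀ v, (α.eV : Γ.V → Γ.V)^[p] v = v)
    (hred : ∀ F, Γ.IsForest F → F.Nonempty → ¬ (∀ e ∈ F, α.eE e ∈ F))
    (hfix : ∀ v, α.eV v = v) {e : Γ.E} (he : Γ.src e ≠ Γ.t e) : α.eE e ≠ e :=
  fun h => he (fixed_loop hp hαE hαV hred hfix h)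

theorem grow
    (hp : p.Prime)
    (hαE : ∀ e, (α.eE : Γ.E → Γ.E)^[p] e = e)
    (hαV : ∀ v, (α.eV : Γ.V → Γ.V)^[p] v = v)
    (hred : ∀ F, Γ.IsForest F → F.Nonempty → ¬ (∀ e ∈ F, α.eE e ∈ F))
    (hp3 : 3 < p) (hconn : Γ.Connected) (hfix : ∀ v, α.eV v = v) (v0 : Γ.V) (j : ℕ)
    (hj : j + 1 ≤ Nat.card Γ.V) :
    ∃ S : Finset Γ.V, v0 ∈ S ∧ S.card = j + 1 ∧
      2 * p * j ≤ Nat.card {e // Γ.src e ∈ S ∧ Γ.t e ∈ S} := by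
  classical
  induction j with
  | zero => exact ⟨{v0}, by simp, by simp, by simp⟩
  | succ j ih =>
    obtain ⟨S, h0, hS, hc⟩ := ih (by omega)
    have hex : ∃ w, w ∉ S := by
      by_contra h
      push Not at h
      have : S = Finset.univ := Finset.eq_univ_iff_forall.2 h
      rw [this, Finset.card_univ, ← Nat.card_eq_fintype_card] at hS
      omega
    obtain ⟨w, hw⟩ := hex
    obtain ⟨e, he1, he2⟩ := cut hconn (fun v => v ∈ S) h0 hw
    have hnl : Γ.src e ≠ Γ.t e := fun h => he2 (h ▸ he1)
    have hnf := nonloop_nf hp hαE hαV hred hfix hnl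
    refine ⟨insert (Γ.t e) S, by simp [h0], by rw [Finset.card_insert_of_notMem he2, hS], ?_⟩
    have hmem : ∀ x : Fin p × Bool, Γ.src (orb p α e x) ∈ insert (Γ.t e) S ∧
        Γ.t (orb p α e x) ∈ insert (Γ.t e) S := by
      rintro ⟨i, b⟩
      cases b
      · rw [orb_src_false hfix, orb_t_false hfix]; simp [he1]
      · rw [orb_src_true hfix, orb_t_true hfix]; simp [he1]
    have hnot : ∀ x : Fin p × Bool, ¬ (Γ.src (orb p α e x) ∈ S ∧ Γ.t (orb p α e x) ∈ S) := by
      rintro ⟨i, b⟩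
      cases b
      · rw [orb_src_false hfix]; exact fun h => he2 h.1
      · rw [orb_t_true hfix]; exact fun h => he2 h.2
    let F : {e // Γ.src e ∈ S ∧ Γ.t e ∈ S} ⊕ (Fin p × Bool) →
        {f // Γ.src f ∈ insert (Γ.t e) S ∧ Γ.t f ∈ insert (Γ.t e) S} :=
      Sum.elim (fun f => ⟨f.1, Finset.mem_insert_of_mem f.2.1, Finset.mem_insert_of_mem f.2.2⟩)
        (fun x => ⟨orb p α e x, hmem x⟩)
    have hF : Function.Injective F := by
      rintro (x | x) (y | y) h
      · have h0 := congrArg Subtype.val h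
        have h' : x.1 = y.1 := h0
        exact congrArg Sum.inl (Subtype.ext h')
      · have h' : x.1 = orb p α e y := congrArg Subtype.val h
        exact absurd (h' ▸ x.2) (hnot y)
      · have h' : orb p α e x = y.1 := congrArg Subtype.val h
        exact absurd (h' ▸ y.2) (hnot x)
      · exact congrArg Sum.inr (orb_inj hp hαE hp3 hnf (congrArg Subtype.val h))
    have := Nat.card_le_card_of_injective F hF
    rw [Nat.card_sum] at this
    simp only [Nat.card_prod, Nat.card_eq_fintype_card (α := Fin p),
      Nat.card_eq_fintype_card (α := Bool), Fintype.card_fin, Fintype.card_bool] at this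
    calc 2 * p * (j + 1) = 2 * p * j + p * 2 := by ring
      _ ≤ _ := by omega

theorem card_V_le
    (hp : p.Prime)
    (hαE : ∀ e, (α.eE : Γ.E → Γ.E)^[p] e = e)
    (hαV : ∀ v, (α.eV : Γ.V → Γ.V)^[p] v = v)
    (hred : ∀ F, Γ.IsForest F → F.Nonempty → ¬ (∀ e ∈ F, α.eE e ∈ F))
    (hp3 : 3 < p) (hconn : Γ.Connected) (hfix : ∀ v, α.eV v = v) (v0 : Γ.V)
    (hE : Nat.card Γ.E + 6 = 4 * p + 2 * Nat.card Γ.V) : Nat.card Γ.V ≤ 3 := by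
  have hpos : 0 < Nat.card Γ.V := by
    have : Nonempty Γ.V := ⟨v0⟩
    exact Nat.card_pos
  obtain ⟨j, hj⟩ : ∃ j, Nat.card Γ.V = j + 1 := ⟨Nat.card Γ.V - 1, by omega⟩
  obtain ⟨S, -, -, h⟩ := grow hp hαE hαV hred hp3 hconn hfix v0 j hj.ge
  have h2 : Nat.card {e // Γ.src e ∈ S ∧ Γ.t e ∈ S} ≤ Nat.card Γ.E :=
    Nat.card_le_card_of_injective _ Subtype.val_injective
  by_contra hcon
  have h3 : 3 ≤ j := by omega
  obtain ⟨q, rfl⟩ : ∃ q, p = q + 4 := ⟨p - 4, by omega⟩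
  obtain ⟨r, rfl⟩ : ∃ r, j = r + 3 := ⟨j - 3, by omega⟩
  nlinarith

/-! ### The three cases -/

theorem pair_inj {X : Type} {a b : X} (h : a ≠ b) :
    Function.Injective (fun i : Fin 2 => if i = 0 then a else b) := by
  intro i j hij
  have h' := h.symm
  fin_cases i <;> fin_cases j <;> first | rfl | (exfalso; simp at hij; contradiction)

theorem triple_inj {X : Type} {a b c : X} (h1 : a ≠ b) (h2 : a ≠ c) (h3 : b ≠ c) :
    Function.Injective (fun i : Fin 3 => if i = 0 then a else if i = 1 then b else c) := by
  intro i j hij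
  have h1' := h1.symm
  have h2' := h2.symm
  have h3' := h3.symm
  fin_cases i <;> fin_cases j <;> first | rfl | (exfalso; simp at hij; contradiction)


/-- `x ≡ y mod p`, `2p + 2y ≤ 2x < 4p + 2y` -/
theorem arith (hp : p.Prime) (hp3 : 3 < p) {x y : ℕ} (h : 2 * x ≡ 2 * y [MOD p])
    (h1 : p + y ≤ x) (h2 : x < 2 * p + y) : x = p + y := by
  have hc : Nat.gcd p 2 = 1 :=
    (Nat.coprime_primes hp Nat.prime_two).2 (by omega)
  have h5 : x ≡ y [MOD p] := Nat.ModEq.cancel_left_of_coprime hc h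
  have h6 : p ∣ x - y := (Nat.modEq_iff_dvd' (by omega)).1 h5.symm
  obtain ⟨c, hcc⟩ := h6
  have : c < 2 := by
    by_contra hcon
    have : p * 2 ≤ p * c := Nat.mul_le_mul_left _ (by omega)
    omega
  interval_cases c <;> omega

theorem rose_case
    (hp : p.Prime)
    (hαE : ∀ e, (α.eE : Γ.E → Γ.E)^[p] e = e)
    (hαV : ∀ v, (α.eV : Γ.V → Γ.V)^[p] v = v)
    (hred : ∀ F, Γ.IsForest F → F.Nonempty → ¬ (∀ e ∈ F, α.eE e ∈ F))
    (hp3 : 3 < p) (hfix : ∀ v, α.eV v = v) (v0 : Γ.V) (hV : ∀ v, v = v0)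
    (hE : Nat.card Γ.E = 2 * (2 * p - 2)) {e : Γ.E} (he : α.eE e ≠ e) :
    ∃ (ψ : GIso Γ (roseModel p (p - 2))) (m : ℕ), m % p ≠ 0 ∧
      (∀ e, ψ.eE (α.eE e) = ((roseRot p (p - 2)).eE : _ → _)^[m] (ψ.eE e)) ∧
      (∀ v, ψ.eV (α.eV v) = ψ.eV v) := by
  obtain ⟨n, φ, hφi, hφ, hφσ, hn⟩ := loops hp hαE hαV hred hfix v0
  have hfx : Nat.card {e // α.eE e = e} = 2 * n := by
    rw [← hn]
    exact Nat.card_congr (Equiv.subtypeEquivRight fun e => ⟨fun h => ⟨h, hV _⟩, fun h => h.1⟩)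
  let f : (roseModel p n).E → Γ.E := fun x =>
    match x with
    | (Sum.inl i, b) => orb p α e (i, b)
    | (Sum.inr i, b) => φ (i, b)
  have hf : Function.Injective f := by
    rintro ⟨i | i, b⟩ ⟨j | j, c⟩ h
    · have := orb_inj hp hαE hp3 he h
      simp only [Prod.mk.injEq] at this
      rw [this.1, this.2]
    · have h' : orb p α e (i, b) = φ (j, c) := h
      exact absurd (h' ▸ (hφ (j, c)).1) (orb_nf he _)
    · have h' : φ (i, b) = orb p α e (j, c) := h
      exact absurd (h' ▸ (hφ (i, b)).1) (orb_nf he _)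
    · have := hφi h
      simp only [Prod.mk.injEq] at this
      rw [this.1, this.2]
  have hcM : Nat.card (roseModel p n).E = 2 * (p + n) := by
    change Nat.card ((Fin p ⊕ Fin n) × Bool) = _
    simp [mul_comm]
  have hle := Nat.card_le_card_of_injective f hf
  rw [hcM, hE] at hle
  have hmod := card_mod hp _ hαE
  rw [hfx, hE] at hmod
  have := arith hp hp3 hmod (by omega) (by omega)
  have hn' : n = p - 2 := by omega
  subst hn'
  refine mkIso hp3 hfix (roseModel p (p - 2)) (roseRot p (p - 2)) (fun _ => v0)
    ⟨fun _ _ _ => rfl, fun v => ⟨(), (hV v).symm⟩⟩ f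
    (hf.bijective_of_nat_card_le (by rw [hcM, hE]; omega)) ?_ (fun _ => hV _) ?_
  · rintro ⟨i | i, b⟩
    · exact orb_inv e i b
    · exact hφσ i b
  · rintro ⟨i | i, b⟩
    · exact orb_rot hp hαE e i b
    · exact (hφ (i, b)).1.symm

theorem theta_case
    (hp : p.Prime)
    (hαE : ∀ e, (α.eE : Γ.E → Γ.E)^[p] e = e)
    (hαV : ∀ v, (α.eV : Γ.V → Γ.V)^[p] v = v)
    (hred : ∀ F, Γ.IsForest F → F.Nonempty → ¬ (∀ e ∈ F, α.eE e ∈ F))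
    (hp3 : 3 < p) (hfix : ∀ v, α.eV v = v) {e : Γ.E} (hl : Γ.src e ≠ Γ.t e)
    (hV : ∀ v, v = Γ.src e ∨ v = Γ.t e)
    (hE : Nat.card Γ.E = 2 * (2 * p - 1)) :
    ∃ (s t : ℕ) (_ : s + t = p - 1) (ψ : GIso Γ (thetaModel p s t)) (m : ℕ),
      m % p ≠ 0 ∧
      (∀ e, ψ.eE (α.eE e) = ((thetaRot p s t).eE : _ → _)^[m] (ψ.eE e)) ∧
      (∀ v, ψ.eV (α.eV v) = ψ.eV v) := by
  classical
  have he := nonloop_nf hp hαE hαV hred hfix hl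
  obtain ⟨s, φ, hφi, hφ, hφσ, hs⟩ := loops hp hαE hαV hred hfix (Γ.src e)
  obtain ⟨t, χ, hχi, hχ, hχσ, ht⟩ := loops hp hαE hαV hred hfix (Γ.t e)
  have hfx : Nat.card {f // α.eE f = f} = 2 * (s + t) := by
    rw [mul_add, ← hs, ← ht, ← Nat.card_sum]
    refine (Nat.card_congr (Equiv.ofBijective (Sum.elim (fun f => ⟨f.1, f.2.1⟩)
      (fun f => ⟨f.1, f.2.1⟩)) ⟨?_, ?_⟩)).symm
    · rintro (x | x) (y | y) h
      · have h0 := congrArg Subtype.val h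
        have h' : x.1 = y.1 := h0
        exact congrArg Sum.inl (Subtype.ext h')
      · have h' : x.1 = y.1 := congrArg Subtype.val h
        exact absurd (by rw [← x.2.2, h', y.2.2]) hl
      · have h' : x.1 = y.1 := congrArg Subtype.val h
        exact absurd (by rw [← y.2.2, ← h', x.2.2]) hl
      · have h0 := congrArg Subtype.val h
        have h' : x.1 = y.1 := h0
        exact congrArg Sum.inr (Subtype.ext h')
    · rintro ⟨f, hf⟩
      rcases hV (Γ.t f) with h | h
      · exact ⟨Sum.inl ⟨f, hf, h⟩, rfl⟩
      · exact ⟨Sum.inr ⟨f, hf, h⟩, rfl⟩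
  let f : (thetaModel p s t).E → Γ.E := fun x =>
    match x with
    | Sum.inl y => orb p α e y
    | Sum.inr (Sum.inl i, b) => φ (i, b)
    | Sum.inr (Sum.inr i, b) => χ (i, b)
  have hf : Function.Injective f := by
    rintro (x | ⟨i | i, b⟩) (y | ⟨j | j, c⟩) h
    · exact congrArg Sum.inl (orb_inj hp hαE hp3 he h)
    · have h' : orb p α e x = φ (j, c) := h
      exact absurd (h' ▸ (hφ (j, c)).1) (orb_nf he _)
    · have h' : orb p α e x = χ (j, c) := h
      exact absurd (h' ▸ (hχ (j, c)).1) (orb_nf he _)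
    · have h' : φ (i, b) = orb p α e y := h
      exact absurd (h' ▸ (hφ (i, b)).1) (orb_nf he _)
    · have := hφi h
      simp only [Prod.mk.injEq] at this
      rw [this.1, this.2]
    · have h' : φ (i, b) = χ (j, c) := h
      exact absurd (by rw [← (hφ (i, b)).2, h', (hχ (j, c)).2]) hl
    · have h' : χ (i, b) = orb p α e y := h
      exact absurd (h' ▸ (hχ (i, b)).1) (orb_nf he _)
    · have h' : χ (i, b) = φ (j, c) := h
      exact absurd (by rw [← (hφ (j, c)).2, ← h', (hχ (i, b)).2]) hl
    · have := hχi h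
      simp only [Prod.mk.injEq] at this
      rw [this.1, this.2]
  have hcM : Nat.card (thetaModel p s t).E = 2 * (p + (s + t)) := by
    change Nat.card ((Fin p × Bool) ⊕ ((Fin s ⊕ Fin t) × Bool)) = _
    rw [Nat.card_sum, Nat.card_prod, Nat.card_prod, Nat.card_sum, Nat.card_fin, Nat.card_fin,
      Nat.card_fin, Nat.card_eq_fintype_card, Fintype.card_bool]
    ring
  have hle := Nat.card_le_card_of_injective f hf
  rw [hcM, hE] at hle
  have hmod := card_mod hp _ hαE
  rw [hfx, hE] at hmod
  have := arith hp hp3 hmod (by omega) (by omega)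
  refine ⟨s, t, by omega, ?_⟩
  refine mkIso hp3 hfix (thetaModel p s t) (thetaRot p s t)
    (fun i : Fin 2 => if i = 0 then Γ.src e else Γ.t e) ⟨?_, ?_⟩ f
    (hf.bijective_of_nat_card_le (by rw [hcM, hE]; omega)) ?_ ?_ ?_
  · exact pair_inj hl
  · intro v
    rcases hV v with h | h
    · exact ⟨(0 : Fin 2), by simp [h]⟩
    · exact ⟨(1 : Fin 2), by simp [h]⟩
  · rintro (⟨i, b⟩ | ⟨i | i, b⟩)
    · exact orb_inv e i b
    · exact hφσ i b
    · exact hχσ i b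
  · rintro (⟨i, b | b⟩ | ⟨i | i, b⟩)
    · exact orb_t_false hfix e i
    · exact orb_t_true hfix e i
    · exact (hφ (i, b)).2
    · exact (hχ (i, b)).2
  · rintro (⟨i, b⟩ | ⟨i | i, b⟩)
    · exact orb_rot hp hαE e i b
    · exact (hφ (i, b)).1.symm
    · exact (hχ (i, b)).1.symm

theorem wedge_case
    (hp : p.Prime)
    (hαE : ∀ e, (α.eE : Γ.E → Γ.E)^[p] e = e)
    (hαV : ∀ v, (α.eV : Γ.V → Γ.V)^[p] v = v)
    (hred : ∀ F, Γ.IsForest F → F.Nonempty → ¬ (∀ e ∈ F, α.eE e ∈ F))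
    (hp3 : 3 < p) (hfix : ∀ v, α.eV v = v) {e e' : Γ.E}
    (hs : Γ.src e' = Γ.src e) (hl : Γ.src e ≠ Γ.t e) (hl' : Γ.src e ≠ Γ.t e')
    (hne : Γ.t e ≠ Γ.t e')
    (hV : ∀ v, v = Γ.t e ∨ v = Γ.src e ∨ v = Γ.t e')
    (hE : Nat.card Γ.E = 2 * (2 * p)) :
    ∃ (ψ : GIso Γ (wedgeModel p)) (m : ℕ), m % p ≠ 0 ∧
      (∀ e, ψ.eE (α.eE e) = ((wedgeRot p).eE : _ → _)^[m] (ψ.eE e)) ∧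
      (∀ v, ψ.eV (α.eV v) = ψ.eV v) := by
  have he := nonloop_nf hp hαE hαV hred hfix hl
  have he' : α.eE e' ≠ e' := nonloop_nf hp hαE hαV hred hfix (by rw [hs]; exact hl')
  let f : (wedgeModel p).E → Γ.E := fun x =>
    match x with
    | Sum.inl y => orb p α e y
    | Sum.inr y => orb p α e' y
  have hcross : ∀ x y, orb p α e x ≠ orb p α e' y := by
    rintro ⟨i, b⟩ ⟨j, c⟩ h
    have h1 := congrArg Γ.t h
    have h2 := congrArg Γ.src h
    cases b <;> cases c <;>
      simp only [orb_t_false hfix, orb_t_true hfix, orb_src_false hfix, orb_src_true hfix, hs]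
        at h1 h2
    · exact hne h2
    · exact hl' h1
    · exact hl' h2
    · exact hne h1
  have hf : Function.Injective f := by
    rintro (x | x) (y | y) h
    · exact congrArg Sum.inl (orb_inj hp hαE hp3 he h)
    · exact absurd h (hcross _ _)
    · exact absurd h.symm (hcross _ _)
    · exact congrArg Sum.inr (orb_inj hp hαE hp3 he' h)
  have hcM : Nat.card (wedgeModel p).E = 2 * (2 * p) := by
    change Nat.card ((Fin p × Bool) ⊕ (Fin p × Bool)) = _
    simp
    ring
  refine mkIso hp3 hfix (wedgeModel p) (wedgeRot p)
    (fun i : Fin 3 => if i = 0 then Γ.t e else if i = 1 then Γ.src e else Γ.t e') ⟨?_, ?_⟩ f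
    (hf.bijective_of_nat_card_le (by rw [hcM, hE])) ?_ ?_ ?_
  · exact triple_inj hl.symm hne hl'
  · intro v
    rcases hV v with h | h | h
    · exact ⟨(0 : Fin 3), by simp [h]⟩
    · exact ⟨(1 : Fin 3), by simp [h]⟩
    · exact ⟨(2 : Fin 3), by simp [h]⟩
  · rintro (⟨i, b⟩ | ⟨i, b⟩)
    · exact orb_inv e i b
    · exact orb_inv e' i b
  · rintro (⟨i, b | b⟩ | ⟨i, b | b⟩)
    · exact orb_t_false hfix e i
    · exact orb_t_true hfix e i
    · exact (orb_t_false hfix e' i).trans hs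
    · exact orb_t_true hfix e' i
  · rintro (⟨i, b⟩ | ⟨i, b⟩)
    · exact orb_rot hp hαE e i b
    · exact orb_rot hp hαE e' i b

end Aux

/-!
STATEMENT 18.  Let `p > 3` be a prime and let `Γ` be a connected `Z/p`-reduced
`Z/p`-graph of rank `n = 2(p-1)` on which `Z/p` acts nontrivially.  Then `Γ` is
isomorphic as a `Z/p`-graph to one of: the rose `R_{2(p-1)}` with `Z/p` cyclically
permuting `p` of the petals and fixing the remaining `p-2`; a graph `Θ_{p-1}^{s,t}`
with `s + t = p - 1`, with `Z/p` cyclically rotating the `p` edges of `Θ_{p-1}` and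
fixing all attached loops; or `Θ_{p-1} ∨ Θ_{p-1}` with the diagonal `Z/p`-action.

The `Z/p`-action is encoded by a graph automorphism `α` with `α^p = 1` and `α ≠ 1`; an
equivariant isomorphism is allowed to intertwine `α` with some generator (a power
`m ≢ 0 (mod p)` of the standard rotation) of the `Z/p`-action on the model graph.
-/
theorem statement18 (p : ℕ) (hp : p.Prime) (hp3 : 3 < p)
    (Γ : FinGraph) (α : GIso Γ Γ)
    -- `α` generates an action of `Z/p`:
    (hαE : ∀ e, (α.eE : Γ.E → Γ.E)^[p] e = e)
    (hαV : ∀ v, (α.eV : Γ.V → Γ.V)^[p] v = v)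
    -- the action is nontrivial:
    (hnt : (∃ e, α.eE e ≠ e) ∨ (∃ v, α.eV v ≠ v))
    -- `Γ` is connected of rank `2(p-1)`:
    (hconn : Γ.Connected) (hrank : Γ.rank = 2 * (p - 1))
    -- `Γ` is `Z/p`-reduced: it contains no nonempty invariant forest:
    (hred : ∀ F, Γ.IsForest F → F.Nonempty → ¬ (∀ e ∈ F, α.eE e ∈ F)) :
    -- conclusion: `Γ` is equivariantly isomorphic to one of the three models
    (∃ (ψ : GIso Γ (roseModel p (p - 2))) (m : ℕ), m % p ≠ 0 ∧
      (∀ e, ψ.eE (α.eE e) = ((roseRot p (p - 2)).eE : _ → _)^[m] (ψ.eE e)) ∧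
      (∀ v, ψ.eV (α.eV v) = ψ.eV v)) ∨
    (∃ (s t : ℕ) (_ : s + t = p - 1) (ψ : GIso Γ (thetaModel p s t)) (m : ℕ),
      m % p ≠ 0 ∧
      (∀ e, ψ.eE (α.eE e) = ((thetaRot p s t).eE : _ → _)^[m] (ψ.eE e)) ∧
      (∀ v, ψ.eV (α.eV v) = ψ.eV v)) ∨
    (∃ (ψ : GIso Γ (wedgeModel p)) (m : ℕ), m % p ≠ 0 ∧
      (∀ e, ψ.eE (α.eE e) = ((wedgeRot p).eE : _ → _)^[m] (ψ.eE e)) ∧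
      (∀ v, ψ.eV (α.eV v) = ψ.eV v)) := by
  classical
  have hfix := all_fixed hp hαE hαV hred hp3 hconn hrank
  obtain ⟨e0, he0⟩ : ∃ e, α.eE e ≠ e := by
    rcases hnt with h | ⟨v, hv⟩
    · exact h
    · exact absurd (hfix v) hv
  have hcE := card_E_even Γ
  have hvc : Γ.vertexCount = Nat.card Γ.V := by
    rw [FinGraph.vertexCount, ← Nat.card_eq_fintype_card]
  rw [FinGraph.rank, hvc] at hrank
  have hE : Nat.card Γ.E + 6 = 4 * p + 2 * Nat.card Γ.V := by omega
  have hV3 := card_V_le hp hαE hαV hred hp3 hconn hfix (Γ.t e0) hE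
  have hcard : ∀ S : Finset Γ.V, (∀ v, v ∈ S) → Nat.card Γ.V = S.card := by
    intro S hS
    rw [Finset.eq_univ_iff_forall.2 hS, Finset.card_univ, Nat.card_eq_fintype_card]
  by_cases h1 : ∀ v, v = Γ.t e0
  · left
    have hc := hcard {Γ.t e0} (by simpa using h1)
    rw [Finset.card_singleton] at hc
    exact rose_case hp hαE hαV hred hp3 hfix (Γ.t e0) h1 (by omega) he0
  push Not at h1
  obtain ⟨w, hw⟩ := h1
  obtain ⟨e1, ha, hb⟩ := cut hconn (fun v => v = Γ.t e0) rfl hw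
  have hl : Γ.src e1 ≠ Γ.t e1 := fun h => hb (by rw [← h]; exact ha)
  by_cases h2 : ∀ v, v = Γ.src e1 ∨ v = Γ.t e1
  · right; left
    have hc := hcard {Γ.src e1, Γ.t e1} (by simpa using h2)
    rw [Finset.card_pair hl] at hc
    exact theta_case hp hαE hαV hred hp3 hfix hl h2 (by omega)
  push Not at h2
  obtain ⟨w', hw'⟩ := h2
  obtain ⟨e2, hc, hd⟩ := cut hconn (fun v => v = Γ.src e1 ∨ v = Γ.t e1) (u := Γ.src e1)
    (w := w') (Or.inl rfl) (by simpa using hw')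
  push Not at hd
  right; right
  let S : Finset Γ.V := {Γ.src e1, Γ.t e1, Γ.t e2}
  have hS : S.card = 3 := Finset.card_eq_three.2 ⟨_, _, _, hl, hd.1.symm, hd.2.symm, rfl⟩
  have hSu : S = Finset.univ := by
    apply Finset.eq_univ_of_card
    apply le_antisymm (Finset.card_le_univ _)
    rw [hS, ← Nat.card_eq_fintype_card]
    exact hV3
  have hmem : ∀ v, v = Γ.src e1 ∨ v = Γ.t e1 ∨ v = Γ.t e2 := by
    intro v
    have : v ∈ S := by rw [hSu]; exact Finset.mem_univ v
    simpa [S] using this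
  have hk : Nat.card Γ.V = 3 := by
    rw [← hS, hSu, Finset.card_univ, Nat.card_eq_fintype_card]
  rcases hc with hc | hc
  · refine wedge_case hp hαE hαV hred hp3 hfix (e := e1) (e' := e2) hc hl hd.1.symm hd.2.symm
      ?_ (by omega)
    intro v
    have := hmem v
    tauto
  · refine wedge_case hp hαE hαV hred hp3 hfix (e := Γ.edgeInv e1) (e' := e2)
      (by rw [src_inv, hc]) (by rw [src_inv, t_inv]; exact hl.symm)
      (by rw [src_inv]; exact hd.2.symm) (by rw [t_inv]; exact hd.1.symm) ?_ (by omega)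
    intro v
    have := hmem v
    rw [src_inv, t_inv]
    exact this

end OutFormal
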